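/- arXiv:1301.1663 — 4 statements merged into one kernel-verified Lean document; each statement's English description precedes it below -/
import Mathlib

section
/- Let V ⊆ ℂ be a nonempty simply connected domain and let G be a nonconstant meromorphic function on V such that the meromorphic functions 1/G' and G²/G' extend holomorphically to V. Then there exist holomorphic functions w₁, w₂ on V such that: (i) 2w₁² equals the holomorphic extension of 1/G' and 2w₂² equals the holomorphic extension of G²/G'; (ii) w₂ = G · w₁ away from the poles of G; (iii) the Wronskian satisfies w₁ w₂' − w₂ w₁' = 1/2 on V; and (iv) there is a holomorphic function ρ on V which equals 2{G, z} away from the poles of G and zeros of G', such that wᵢ'' + (ρ/4) wᵢ = 0 on V for i = 1, 2. (In the paper's formulation: for Weierstrass data (G, h dz) of a minimal immersion with Hopf differential Q = dz², i.e. h = −G/G', the functions w₁ = (√2/2)√(−G⁻¹h) and w₂ = (√2/2)√(−G h) are single-valued and solve Hill's equation with Wronskian 1/2, where the branches are chosen so that w₂/w₁ = G.) -/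
/-- The Schwarzian derivative `{G, z} = (G''/G')' - (1/2)(G''/G')²`. -/
noncomputable def schwarzian (G : ℂ → ℂ) (z : ℂ) : ℂ :=
  deriv (fun w => deriv (deriv G) w / deriv G w) z
    - (1 / 2) * (deriv (deriv G) z / deriv G z) ^ 2

open Topology

theorem exists_continuous_lift_of_local_lift_up_to_sign {A : Type*} [TopologicalSpace A]
    [SimplyConnectedSpace A] [LocallyPathConnectedSpace A]
    (σ : A → ℂ × ℂ) (hσ : ∀ a, σ a ≠ 0)
    (hloc : ∀ a, ∃ u : A → ℂ × ℂ, ContinuousAt u a ∧ ∀ᶠ b in 𝓝 a, u b = σ b ∨ u b = -σ b) :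
    ∃ τ : A → ℂ × ℂ, Continuous τ ∧ ∀ a, τ a = σ a ∨ τ a = -σ a := by
  let q : ℂ × ℂ → Quotient (MulAction.orbitRel ℤˣ (ℂ × ℂ)) := Quotient.mk _
  have hq : Continuous q := continuous_quotient_mk'
  have hqeq : ∀ x y : ℂ × ℂ, q x = q y ↔ x = y ∨ x = -y := by
    intro x y
    refine Quotient.eq.trans ?_
    rw [MulAction.orbitRel_apply, MulAction.mem_orbit_iff]
    constructor
    · rintro ⟨g, rfl⟩
      rcases Int.units_eq_one_or g with rfl | rfl
      · exact .inl (one_smul _ _)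
      · exact .inr (by simp [Units.smul_def])
    · rintro (rfl | rfl)
      · exact ⟨1, one_smul _ _⟩
      · exact ⟨-1, by simp [Units.smul_def]⟩
  have hcov : IsCoveringMapOn q (q '' {e | MulAction.stabilizer ℤˣ e = ⊥}) :=
    isCoveringMapOn_quotientMk_of_properlyDiscontinuousSMul
  have hstab : ∀ e : ℂ × ℂ, e ≠ 0 → MulAction.stabilizer ℤˣ e = ⊥ := by
    intro e he
    rw [eq_bot_iff]
    intro g hg
    rcases Int.units_eq_one_or g with rfl | rfl
    · exact Subgroup.one_mem _
    · rw [MulAction.mem_stabilizer_iff] at hg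
      exact absurd (self_eq_neg.1 (by simpa [Units.smul_def] using hg.symm)) he
  have hf : Continuous (fun a => q (σ a)) := by
    rw [continuous_iff_continuousAt]
    intro a
    obtain ⟨u, hu, hus⟩ := hloc a
    refine (hq.continuousAt.comp hu).congr ?_
    filter_upwards [hus] with b hb using (hqeq _ _).2 hb
  obtain ⟨a₀⟩ := (inferInstance : Nonempty A)
  obtain ⟨τ, ⟨-, hτ⟩, -⟩ := hcov.existsUnique_continuousMap_lifts ⟨_, hf⟩ (a₀ := a₀)
    (e₀ := σ a₀) rfl (fun a => ⟨σ a, hstab _ (hσ a), rfl⟩)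
  exact ⟨τ, τ.continuous, fun a => (hqeq _ _).1 (congrFun hτ a)⟩

theorem exists_differentiableAt_sqrt_pair_of_ne_zero {F₁ F₂ F₃ : ℂ → ℂ} {z₀ : ℂ}
    (h₁ : DifferentiableAt ℂ F₁ z₀) (h₃ : DifferentiableAt ℂ F₃ z₀)
    (hF : ∀ᶠ z in 𝓝 z₀, F₃ z ^ 2 = F₁ z * F₂ z) (h0 : F₁ z₀ ≠ 0) :
    ∃ u₁ u₂ : ℂ → ℂ, DifferentiableAt ℂ u₁ z₀ ∧ DifferentiableAt ℂ u₂ z₀ ∧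
      ∀ᶠ z in 𝓝 z₀, 2 * u₁ z ^ 2 = F₁ z ∧ 2 * u₂ z ^ 2 = F₂ z ∧ 2 * u₁ z * u₂ z = F₃ z := by
  obtain ⟨a, ha⟩ := IsAlgClosed.exists_pow_nat_eq (F₁ z₀ / 2) two_pos
  have ha0 : a ≠ 0 := by rintro rfl; exact h0 (by simpa using ha.symm)
  let u : ℂ → ℂ := fun z => a * (F₁ z / F₁ z₀) ^ (1 / 2 : ℂ)
  have hu : DifferentiableAt ℂ u z₀ := by
    refine (DifferentiableAt.cpow (h₁.div_const _) (by fun_prop) ?_).const_mul a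
    simp [h0]
  have hu0 : u z₀ ≠ 0 := by simp [u, h0, ha0]
  refine ⟨u, fun z => F₃ z / (2 * u z), hu, h₃.div (hu.const_mul 2) (by simpa using hu0), ?_⟩
  filter_upwards [hF, h₁.continuousAt.eventually_ne h0, hu.continuousAt.eventually_ne hu0]
    with z hz hz0 huz
  have hsq : 2 * u z ^ 2 = F₁ z := by
    have : ((F₁ z / F₁ z₀) ^ (1 / 2 : ℂ)) ^ 2 = F₁ z / F₁ z₀ := by
      rw [← Complex.cpow_nat_mul]; norm_num
    simp only [u, mul_pow, this, ha]
    field_simp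
  refine ⟨hsq, ?_, by field_simp⟩
  rw [← hsq] at hz
  field_simp
  linear_combination hz

theorem exists_differentiableAt_sqrt_pair {F₁ F₂ F₃ : ℂ → ℂ} {z₀ : ℂ}
    (h₁ : DifferentiableAt ℂ F₁ z₀) (h₂ : DifferentiableAt ℂ F₂ z₀)
    (h₃ : DifferentiableAt ℂ F₃ z₀)
    (hF : ∀ᶠ z in 𝓝 z₀, F₃ z ^ 2 = F₁ z * F₂ z) (h0 : F₁ z₀ ≠ 0 ∨ F₂ z₀ ≠ 0) :
    ∃ u₁ u₂ : ℂ → ℂ, DifferentiableAt ℂ u₁ z₀ ∧ DifferentiableAt ℂ u₂ z₀ ∧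
      ∀ᶠ z in 𝓝 z₀, 2 * u₁ z ^ 2 = F₁ z ∧ 2 * u₂ z ^ 2 = F₂ z ∧ 2 * u₁ z * u₂ z = F₃ z := by
  rcases h0 with h0 | h0
  · exact exists_differentiableAt_sqrt_pair_of_ne_zero h₁ h₃ hF h0
  · obtain ⟨u₂, u₁, hu₂, hu₁, h⟩ := exists_differentiableAt_sqrt_pair_of_ne_zero h₂ h₃
      (hF.mono fun z hz => hz.trans (mul_comm _ _)) h0
    exact ⟨u₁, u₂, hu₁, hu₂, h.mono fun z hz => ⟨hz.2.1, hz.1, by rw [← hz.2.2]; ring⟩⟩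

theorem eq_or_eq_neg_of_sq_eq_sq_of_mul_eq_mul {a b c d : ℂ} (h₁ : a ^ 2 = c ^ 2)
    (h₂ : b ^ 2 = d ^ 2) (h₃ : a * b = c * d) : (a, b) = (c, d) ∨ (a, b) = -(c, d) := by
  simp only [Prod.neg_mk, Prod.mk.injEq]
  rcases sq_eq_sq_iff_eq_or_eq_neg.1 h₁ with h | h <;>
  rcases sq_eq_sq_iff_eq_or_eq_neg.1 h₂ with h' | h' <;> subst h h' <;> grind

theorem exists_differentiableOn_sqrt_pair {V : Set ℂ} (hV : IsOpen V)
    [SimplyConnectedSpace V] {F₁ F₂ F₃ : ℂ → ℂ}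
    (h₁ : DifferentiableOn ℂ F₁ V) (h₂ : DifferentiableOn ℂ F₂ V) (h₃ : DifferentiableOn ℂ F₃ V)
    (hF : ∀ z ∈ V, F₃ z ^ 2 = F₁ z * F₂ z) (h0 : ∀ z ∈ V, F₁ z ≠ 0 ∨ F₂ z ≠ 0) :
    ∃ w₁ w₂ : ℂ → ℂ, DifferentiableOn ℂ w₁ V ∧ DifferentiableOn ℂ w₂ V ∧
      ∀ z ∈ V, 2 * w₁ z ^ 2 = F₁ z ∧ 2 * w₂ z ^ 2 = F₂ z ∧ 2 * w₁ z * w₂ z = F₃ z := by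
  classical
  have hloc : ∀ z ∈ V, ∃ u₁ u₂ : ℂ → ℂ, DifferentiableAt ℂ u₁ z ∧ DifferentiableAt ℂ u₂ z ∧
      ∀ᶠ y in 𝓝 z, 2 * u₁ y ^ 2 = F₁ y ∧ 2 * u₂ y ^ 2 = F₂ y ∧ 2 * u₁ y * u₂ y = F₃ y := by
    intro z hz
    have hn := hV.mem_nhds hz
    exact exists_differentiableAt_sqrt_pair (h₁.differentiableAt hn) (h₂.differentiableAt hn)
      (h₃.differentiableAt hn) (Filter.eventually_of_mem hn hF) (h0 z hz)
  have hpt : ∀ z : V, ∃ p : ℂ × ℂ, 2 * p.1 ^ 2 = F₁ z ∧ 2 * p.2 ^ 2 = F₂ z ∧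
      2 * p.1 * p.2 = F₃ z := by
    rintro ⟨z, hz⟩
    obtain ⟨u₁, u₂, -, -, h⟩ := hloc z hz
    exact ⟨(u₁ z, u₂ z), h.self_of_nhds⟩
  have huniq : ∀ {a b c d x₁ x₂ x₃ : ℂ}, (2 * a ^ 2 = x₁ ∧ 2 * b ^ 2 = x₂ ∧ 2 * a * b = x₃) →
      (2 * c ^ 2 = x₁ ∧ 2 * d ^ 2 = x₂ ∧ 2 * c * d = x₃) →
      (a, b) = (c, d) ∨ (a, b) = -(c, d) := by
    rintro a b c d x₁ x₂ x₃ ⟨h1, h2, h3⟩ ⟨k1, k2, k3⟩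
    exact eq_or_eq_neg_of_sq_eq_sq_of_mul_eq_mul (by linear_combination (h1 - k1) / 2)
      (by linear_combination (h2 - k2) / 2) (by linear_combination (h3 - k3) / 2)
  choose σ hσ using hpt
  have := hV.locallyPathConnectedSpace
  have hne : ∀ (p : ℂ × ℂ), ∀ z ∈ V, (2 * p.1 ^ 2 = F₁ z ∧ 2 * p.2 ^ 2 = F₂ z) → p ≠ 0 := by
    rintro p z hz ⟨h1, h2⟩ rfl
    rcases h0 z hz with h | h
    · exact h (by simpa using h1.symm)
    · exact h (by simpa using h2.symm)
  obtain ⟨τ, hτc, hτ⟩ := exists_continuous_lift_of_local_lift_up_to_sign σ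
    (fun z => hne _ z z.2 ⟨(hσ z).1, (hσ z).2.1⟩) (by
      intro z
      obtain ⟨u₁, u₂, hu₁, hu₂, h⟩ := hloc z z.2
      refine ⟨fun y => (u₁ y, u₂ y),
        (hu₁.continuousAt.prodMk hu₂.continuousAt).comp continuousAt_subtype_val, ?_⟩
      filter_upwards [continuousAt_subtype_val.eventually h] with y hy using huniq hy (hσ y))
  have hτσ : ∀ z : V, 2 * (τ z).1 ^ 2 = F₁ z ∧ 2 * (τ z).2 ^ 2 = F₂ z ∧
      2 * (τ z).1 * (τ z).2 = F₃ z := by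
    intro z
    rcases hτ z with h | h <;> rw [h]
    · exact hσ z
    · simpa using hσ z
  let w : ℂ → ℂ × ℂ := fun z => if h : z ∈ V then τ ⟨z, h⟩ else 0
  have hw : ∀ z ∈ V, 2 * (w z).1 ^ 2 = F₁ z ∧ 2 * (w z).2 ^ 2 = F₂ z ∧
      2 * (w z).1 * (w z).2 = F₃ z := by
    intro z hz
    simpa [w, hz] using hτσ ⟨z, hz⟩
  have hwc : ContinuousOn w V := by
    rw [continuousOn_iff_continuous_domRestrict]
    refine hτc.congr fun z => ?_
    simp [w]
  have hwd : ∀ z ∈ V, DifferentiableAt ℂ w z := by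
    intro z hz
    have hn := hV.mem_nhds hz
    obtain ⟨u₁, u₂, hu₁, hu₂, h⟩ := hloc z hz
    have hu : DifferentiableAt ℂ (fun y => (u₁ y, u₂ y)) z := hu₁.prodMk hu₂
    have hwz := hwc.continuousAt hn
    have hw0 : w z ≠ 0 := hne _ z hz ⟨(hw z hz).1, (hw z hz).2.1⟩
    have hor : ∀ᶠ y in 𝓝 z, w y = (u₁ y, u₂ y) ∨ w y = -(u₁ y, u₂ y) := by
      filter_upwards [h, hn] with y hy hyV using huniq (hw y hyV) hy
    rcases hor.self_of_nhds with e | e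
    · refine hu.congr_of_eventuallyEq ?_
      have : w z + (u₁ z, u₂ z) ≠ 0 := by
        rw [← e, ← two_smul ℂ]; exact smul_ne_zero two_ne_zero hw0
      filter_upwards [hor, (hwz.add hu.continuousAt).eventually_ne this] with y hy hy'
      exact hy.resolve_right fun hc => hy' (by simp [hc])
    · refine hu.neg.congr_of_eventuallyEq ?_
      have : w z - (u₁ z, u₂ z) ≠ 0 := by
        rw [sub_eq_add_neg, ← e, ← two_smul ℂ]; exact smul_ne_zero two_ne_zero hw0
      filter_upwards [hor, (hwz.sub hu.continuousAt).eventually_ne this] with y hy hy'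
      exact hy.resolve_left fun hc => hy' (by simp [hc])
  exact ⟨fun z => (w z).1, fun z => (w z).2,
    fun z hz => (hwd z hz).fst.differentiableWithinAt,
    fun z hz => (hwd z hz).snd.differentiableWithinAt, hw⟩

theorem eq_of_eventually_nhdsNE_eq {f g : ℂ → ℂ} {z₀ : ℂ} (hf : ContinuousAt f z₀)
    (hg : ContinuousAt g z₀) (h : ∀ᶠ z in 𝓝[≠] z₀, f z = g z) : f z₀ = g z₀ :=
  ((hf.eventuallyEq_nhds_iff_eventuallyEq_nhdsNE hg).1 h).self_of_nhds

/-- Comparing vanishing orders: if the square of the Wronskian of `f` and `g` is `4 f g`, then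
`f` and `g` have no common zero of finite order. -/
theorem ne_zero_or_ne_zero_of_wronskian_sq_eq {f g : ℂ → ℂ} {z₀ : ℂ} (hf : AnalyticAt ℂ f z₀)
    (hg : AnalyticAt ℂ g z₀) (hf0 : ¬ ∀ᶠ z in 𝓝 z₀, f z = 0) (hg0 : ¬ ∀ᶠ z in 𝓝 z₀, g z = 0)
    (h : ∀ᶠ z in 𝓝 z₀, (f z * deriv g z - deriv f z * g z) ^ 2 = 4 * (f z * g z)) :
    f z₀ ≠ 0 ∨ g z₀ ≠ 0 := by
  by_contra! hz
  obtain ⟨n, f₁, hf₁, hf₁0, hfe⟩ := hf.exists_eventuallyEq_pow_smul_nonzero_iff.2 hf0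
  obtain ⟨k, g₁, hg₁, hg₁0, hge⟩ := hg.exists_eventuallyEq_pow_smul_nonzero_iff.2 hg0
  obtain ⟨a, rfl⟩ : ∃ a, n = a + 1 := Nat.exists_eq_succ_of_ne_zero (by
    rintro rfl
    exact hf₁0 (by simpa [hz.1] using hfe.self_of_nhds.symm))
  obtain ⟨b, rfl⟩ : ∃ b, k = b + 1 := Nat.exists_eq_succ_of_ne_zero (by
    rintro rfl
    exact hg₁0 (by simpa [hz.2] using hge.self_of_nhds.symm))
  have hderiv : ∀ (m : ℕ) (F F₁ : ℂ → ℂ), AnalyticAt ℂ F₁ z₀ →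
      (∀ᶠ z in 𝓝 z₀, F z = (z - z₀) ^ (m + 1) • F₁ z) →
      ∀ᶠ z in 𝓝 z₀, deriv F z =
        (m + 1) * (z - z₀) ^ m * F₁ z + (z - z₀) ^ (m + 1) * deriv F₁ z := by
    intro m F F₁ hF₁ hFe
    filter_upwards [hFe.eventually_nhds, hF₁.eventually_analyticAt] with z hz hz₁
    have h1 : HasDerivAt (fun z => (z - z₀) ^ (m + 1)) ((m + 1) * (z - z₀) ^ m) z := by
      simpa using ((hasDerivAt_id z).sub_const z₀).fun_pow (m + 1)
    rw [Filter.EventuallyEq.deriv_eq (f := fun z => (z - z₀) ^ (m + 1) * F₁ z) hz]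
    exact (h1.mul hz₁.differentiableAt.hasDerivAt).deriv
  have key : ∀ᶠ z in 𝓝[≠] z₀, (z - z₀) ^ (a + b) *
      ((b - a) * f₁ z * g₁ z + (z - z₀) * (f₁ z * deriv g₁ z - deriv f₁ z * g₁ z)) ^ 2 =
      4 * (f₁ z * g₁ z) := by
    filter_upwards [self_mem_nhdsWithin, nhdsWithin_le_nhds h, nhdsWithin_le_nhds hfe,
      nhdsWithin_le_nhds hge, nhdsWithin_le_nhds (hderiv a f f₁ hf₁ hfe),
      nhdsWithin_le_nhds (hderiv b g g₁ hg₁ hge)] with z hne h hf hg hf' hg'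
    have hne : (z - z₀) ^ (a + b + 2) ≠ 0 := pow_ne_zero _ (sub_ne_zero.2 hne)
    rw [hf', hg', hf, hg] at h
    simp only [smul_eq_mul] at h
    refine mul_left_cancel₀ hne ?_
    linear_combination h
  have c₁ := hf₁.continuousAt
  have c₂ := hg₁.continuousAt
  have c₃ := hf₁.deriv.continuousAt
  have c₄ := hg₁.deriv.continuousAt
  have := eq_of_eventually_nhdsNE_eq (by fun_prop) (by fun_prop) key
  simp only [sub_self, zero_mul, add_zero] at this
  rcases Nat.eq_zero_or_pos (a + b) with hab | hab
  · obtain ⟨rfl, rfl⟩ := Nat.add_eq_zero_iff.1 hab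
    simp [hf₁0, hg₁0] at this
  · rw [zero_pow hab.ne', zero_mul, eq_comm] at this
    simp [hf₁0, hg₁0] at this

theorem MeromorphicOn.eventually_analyticAt_and_deriv_ne_zero {V : Set ℂ} (hV : IsOpen V)
    (hVconn : IsConnected V) {G : ℂ → ℂ} (hG : MeromorphicOn G V)
    (hGnc : ¬ ∃ c : ℂ, ∀ z ∈ V, AnalyticAt ℂ G z → G z = c) :
    ∀ z ∈ V, ∀ᶠ y in 𝓝[≠] z, y ∈ V ∧ AnalyticAt ℂ G y ∧ deriv G y ≠ 0 := by
  have key : ∀ z ∈ V, meromorphicOrderAt (deriv G) z ≠ ⊤ := by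
    rw [← hG.deriv.exists_meromorphicOrderAt_ne_top_iff_forall_mem hVconn]
    by_contra! htop
    apply hGnc
    obtain ⟨z₁, hz₁⟩ := hVconn.nonempty
    obtain ⟨z₂, hz₂, hz₂V⟩ := ((hG z₁ hz₁).eventually_analyticAt.and
      (nhdsWithin_le_nhds (hV.mem_nhds hz₁))).exists
    have hd : ∀ᶠ z in 𝓝 z₂, deriv G z = 0 :=
      (hz₂.deriv.continuousAt.eventuallyEq_nhds_iff_eventuallyEq_nhdsNE continuousAt_const).1
        (meromorphicOrderAt_eq_top_iff.1 (htop z₂ hz₂V))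
    obtain ⟨r, hr, hball⟩ := Metric.eventually_nhds_iff_ball.1 (hd.and hz₂.eventually_analyticAt)
    have hconst : ∀ᶠ z in 𝓝 z₂, G z - G z₂ = 0 := by
      filter_upwards [Metric.ball_mem_nhds z₂ hr] with z hz
      exact sub_eq_zero.2 (Metric.isOpen_ball.is_const_of_deriv_eq_zero
        (convex_ball z₂ r).isPreconnected
        (fun y hy => (hball y hy).2.differentiableAt.differentiableWithinAt)
        (fun y hy => (hball y hy).1) hz (Metric.mem_ball_self hr))
    have hm : MeromorphicOn (fun z => G z - G z₂) V := hG.sub (MeromorphicOn.const _)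
    refine ⟨G z₂, fun z hz hGz => ?_⟩
    have hz_top : meromorphicOrderAt (fun z => G z - G z₂) z = ⊤ := by
      by_contra hne
      exact (hm.exists_meromorphicOrderAt_ne_top_iff_forall_mem hVconn).1 ⟨z, hz, hne⟩ z₂ hz₂V
        (meromorphicOrderAt_eq_top_iff.2 (nhdsWithin_le_nhds hconst))
    refine eq_of_eventually_nhdsNE_eq hGz.continuousAt continuousAt_const ?_
    filter_upwards [meromorphicOrderAt_eq_top_iff.1 hz_top] with y hy using sub_eq_zero.1 hy
  intro z hz
  filter_upwards [nhdsWithin_le_nhds (hV.mem_nhds hz), (hG z hz).eventually_analyticAt,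
    (hG.deriv z hz).eventually_eq_zero_or_eventually_ne_zero.resolve_left
      (fun h => key z hz (meromorphicOrderAt_eq_top_iff.2 h))] with y h₁ h₂ h₃ using ⟨h₁, h₂, h₃⟩

/-- If `2 w² G' = 1` near `z`, then `w'' = -({G, z} / 2) w` at `z`. -/
theorem deriv_deriv_eq_neg_schwarzian_mul {G w : ℂ → ℂ} {z : ℂ} (hG : AnalyticAt ℂ G z)
    (hG' : deriv G z ≠ 0) (hw : AnalyticAt ℂ w z)
    (h : ∀ᶠ y in 𝓝 z, 2 * w y ^ 2 = 1 / deriv G y) :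
    deriv (deriv w) z = -(schwarzian G z / 2 * w z) := by
  have hLd : DifferentiableAt ℂ (fun y => deriv (deriv G) y / deriv G y) z :=
    (hG.deriv.deriv.div hG.deriv hG').differentiableAt
  have hw' : deriv w =ᶠ[𝓝 z] fun y => -(1 / 2) * (deriv (deriv G) y / deriv G y) * w y := by
    filter_upwards [h.eventually_nhds, hG.deriv.continuousAt.eventually_ne hG',
      hG.eventually_analyticAt, hw.eventually_analyticAt] with y hy hGy' hGy hwy
    have hy0 := hy.self_of_nhds
    have hwy0 : w y ≠ 0 := by
      intro h0
      simp [h0, eq_comm, hGy'] at hy0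
    have hd := Filter.EventuallyEq.deriv_eq (f₁ := fun y => 2 * w y ^ 2)
      (f := fun y => 1 / deriv G y) hy
    have h1 : HasDerivAt (fun y => 2 * w y ^ 2) (2 * (2 * w y * deriv w y)) y := by
      simpa using (hwy.differentiableAt.hasDerivAt.pow 2).const_mul 2
    have h2 : HasDerivAt (fun y => 1 / deriv G y) (-deriv (deriv G) y / deriv G y ^ 2) y := by
      simpa using hGy.deriv.differentiableAt.hasDerivAt.fun_inv hGy'
    rw [h1.deriv, h2.deriv] at hd
    field_simp at hd hy0 ⊢
    refine mul_left_cancel₀ (mul_ne_zero two_ne_zero (mul_ne_zero hwy0 hGy')) ?_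
    linear_combination hd + deriv (deriv G) y * hy0
  have hd2 := ((hLd.hasDerivAt.const_mul (-(1 / 2) : ℂ)).mul hw.differentiableAt.hasDerivAt).deriv
  rw [hw'.deriv_eq]
  refine hd2.trans ?_
  rw [hw'.self_of_nhds, schwarzian]
  ring

/-- Let `G` be a nonconstant meromorphic function on a nonempty simply connected
domain `V ⊆ ℂ` such that `1/G'` and `G²/G'` extend holomorphically to `V` (the
extensions being `F₁` and `F₂`).  Then there are holomorphic functions `w₁, w₂`
on `V` with `2w₁² = F₁`, `2w₂² = F₂`, `w₂ = G·w₁` away from the poles of `G`,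
Wronskian `w₁ w₂' - w₂ w₁' = 1/2`, solving Hill's equation `w'' + (ρ/4)w = 0`
for a holomorphic `ρ` that equals `2{G,z}` away from the poles of `G` and zeros
of `G'`. -/
theorem spinor_weierstrass_hill
    (V : Set ℂ) (hV : IsOpen V) (hVconn : IsConnected V)
    (hVsc : SimplyConnectedSpace V)
    (G : ℂ → ℂ) (hG : MeromorphicOn G V)
    (hGnc : ¬ ∃ c : ℂ, ∀ z ∈ V, AnalyticAt ℂ G z → G z = c)
    (F₁ F₂ : ℂ → ℂ)
    (hF₁ : DifferentiableOn ℂ F₁ V) (hF₂ : DifferentiableOn ℂ F₂ V)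
    (hF₁eq : ∀ z ∈ V, AnalyticAt ℂ G z → deriv G z ≠ 0 →
      F₁ z = 1 / deriv G z)
    (hF₂eq : ∀ z ∈ V, AnalyticAt ℂ G z → deriv G z ≠ 0 →
      F₂ z = (G z) ^ 2 / deriv G z) :
    ∃ w₁ w₂ : ℂ → ℂ,
      DifferentiableOn ℂ w₁ V ∧ DifferentiableOn ℂ w₂ V ∧
      (∀ z ∈ V, 2 * (w₁ z) ^ 2 = F₁ z ∧ 2 * (w₂ z) ^ 2 = F₂ z) ∧
      (∀ z ∈ V, AnalyticAt ℂ G z → w₂ z = G z * w₁ z) ∧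
      (∀ z ∈ V, w₁ z * deriv w₂ z - w₂ z * deriv w₁ z = 1 / 2) ∧
      ∃ ρ : ℂ → ℂ, DifferentiableOn ℂ ρ V ∧
        (∀ z ∈ V, AnalyticAt ℂ G z → deriv G z ≠ 0 →
          ρ z = 2 * schwarzian G z) ∧
        (∀ z ∈ V, deriv (deriv w₁) z + ρ z / 4 * w₁ z = 0) ∧
        (∀ z ∈ V, deriv (deriv w₂) z + ρ z / 4 * w₂ z = 0) := by
  have hreg := hG.eventually_analyticAt_and_deriv_ne_zero hV hVconn hGnc
  have hopen : ∀ z ∈ V, AnalyticAt ℂ G z → deriv G z ≠ 0 →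
      ∀ᶠ y in 𝓝 z, y ∈ V ∧ AnalyticAt ℂ G y ∧ deriv G y ≠ 0 := fun z hz hGz hGz' =>
    (hV.eventually_mem hz).and (hGz.eventually_analyticAt.and
      (hGz.deriv.continuousAt.eventually_ne hGz'))
  have hA₁ : ∀ z ∈ V, AnalyticAt ℂ F₁ z := fun z hz => hF₁.analyticAt (hV.mem_nhds hz)
  have hA₂ : ∀ z ∈ V, AnalyticAt ℂ F₂ z := fun z hz => hF₂.analyticAt (hV.mem_nhds hz)
  let F₃ : ℂ → ℂ := fun z => (F₁ z * deriv F₂ z - deriv F₁ z * F₂ z) / 2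
  have hA₃ : ∀ z ∈ V, AnalyticAt ℂ F₃ z := fun z hz =>
    (((hA₁ z hz).mul (hA₂ z hz).deriv).sub ((hA₁ z hz).deriv.mul (hA₂ z hz))).div_const
  have hF₃eq : ∀ z ∈ V, AnalyticAt ℂ G z → deriv G z ≠ 0 → F₃ z = G z * F₁ z := by
    intro z hz hGz hGz'
    have he : F₂ =ᶠ[𝓝 z] fun y => G y ^ 2 * F₁ y := by
      filter_upwards [hopen z hz hGz hGz'] with y ⟨hy, hGy, hGy'⟩
      rw [hF₂eq y hy hGy hGy', hF₁eq y hy hGy hGy', mul_one_div]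
    have hd : deriv F₂ z = 2 * G z * deriv G z * F₁ z + G z ^ 2 * deriv F₁ z := by
      rw [he.deriv_eq]
      simpa using ((hGz.differentiableAt.hasDerivAt.fun_pow 2).fun_mul
        (hA₁ z hz).differentiableAt.hasDerivAt).deriv
    have h1 : F₁ z * deriv G z = 1 := by rw [hF₁eq z hz hGz hGz', one_div_mul_cancel hGz']
    simp only [F₃, hd, he.self_of_nhds]
    linear_combination G z * F₁ z * h1
  have hF₃sq : ∀ z ∈ V, F₃ z ^ 2 = F₁ z * F₂ z := by
    intro z hz
    refine eq_of_eventually_nhdsNE_eq (f := fun z => F₃ z ^ 2) (g := fun z => F₁ z * F₂ z)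
      ((hA₃ z hz).continuousAt.pow 2) ((hA₁ z hz).continuousAt.mul (hA₂ z hz).continuousAt) ?_
    filter_upwards [hreg z hz] with y ⟨hy, hGy, hGy'⟩
    rw [hF₃eq y hy hGy hGy', hF₂eq y hy hGy hGy', hF₁eq y hy hGy hGy']
    ring
  have hF₁ne : ∀ z ∈ V, ¬ ∀ᶠ y in 𝓝 z, F₁ y = 0 := by
    intro z hz h
    obtain ⟨y, hy0, hy, hGy, hGy'⟩ := ((h.filter_mono nhdsWithin_le_nhds).and (hreg z hz)).exists
    rw [hF₁eq y hy hGy hGy'] at hy0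
    exact one_div_ne_zero hGy' hy0
  have hF₂ne : ∀ z ∈ V, ¬ ∀ᶠ y in 𝓝 z, F₂ y = 0 := by
    intro z hz h
    obtain ⟨y, hy0, hy, hGy, hGy'⟩ :=
      ((h.eventually_nhds.filter_mono nhdsWithin_le_nhds).and (hreg z hz)).exists
    have hG0 : G =ᶠ[𝓝 y] fun _ => 0 := by
      filter_upwards [hy0, hopen y hy hGy hGy'] with x hx0 ⟨hx, hGx, hGx'⟩
      simpa [hF₂eq x hx hGx hGx', hGx'] using hx0
    exact hGy' (by rw [hG0.deriv_eq, deriv_const])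
  have h0 : ∀ z ∈ V, F₁ z ≠ 0 ∨ F₂ z ≠ 0 := by
    intro z hz
    refine ne_zero_or_ne_zero_of_wronskian_sq_eq (hA₁ z hz) (hA₂ z hz) (hF₁ne z hz) (hF₂ne z hz) ?_
    filter_upwards [hV.mem_nhds hz] with y hy
    linear_combination 4 * hF₃sq y hy
  obtain ⟨w₁, w₂, hw₁, hw₂, hw⟩ := exists_differentiableOn_sqrt_pair hV hF₁ hF₂
    (fun z hz => (hA₃ z hz).differentiableAt.differentiableWithinAt) hF₃sq h0
  have hW₁ : ∀ z ∈ V, AnalyticAt ℂ w₁ z := fun z hz => hw₁.analyticAt (hV.mem_nhds hz)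
  have hW₂ : ∀ z ∈ V, AnalyticAt ℂ w₂ z := fun z hz => hw₂.analyticAt (hV.mem_nhds hz)
  have hratio : ∀ z ∈ V, AnalyticAt ℂ G z → deriv G z ≠ 0 → w₂ z = G z * w₁ z := by
    intro z hz hGz hGz'
    obtain ⟨h1, -, h3⟩ := hw z hz
    have hw0 : w₁ z ≠ 0 := by
      rintro h
      rw [hF₁eq z hz hGz hGz', h] at h1
      simp [eq_comm, hGz'] at h1
    rw [hF₃eq z hz hGz hGz', ← h1] at h3
    refine mul_left_cancel₀ (mul_ne_zero two_ne_zero hw0) ?_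
    linear_combination h3
  have hwron : ∀ z ∈ V, w₁ z * deriv w₂ z - w₂ z * deriv w₁ z = 1 / 2 := by
    intro z hz
    refine eq_of_eventually_nhdsNE_eq
      (f := fun z => w₁ z * deriv w₂ z - w₂ z * deriv w₁ z) (g := fun _ => 1 / 2)
      (((hW₁ z hz).mul (hW₂ z hz).deriv).sub
        ((hW₂ z hz).mul (hW₁ z hz).deriv)).continuousAt continuousAt_const ?_
    filter_upwards [hreg z hz] with y ⟨hy, hGy, hGy'⟩
    have he : w₂ =ᶠ[𝓝 y] fun x => G x * w₁ x := by
      filter_upwards [hopen y hy hGy hGy'] with x ⟨hx, hGx, hGx'⟩ using hratio x hx hGx hGx'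
    have hd : deriv w₂ y = deriv G y * w₁ y + G y * deriv w₁ y := by
      rw [he.deriv_eq]
      exact (hGy.differentiableAt.hasDerivAt.mul
        (hW₁ y hy).differentiableAt.hasDerivAt).deriv
    have h1 : 2 * w₁ y ^ 2 * deriv G y = 1 := by
      rw [(hw y hy).1, hF₁eq y hy hGy hGy', one_div_mul_cancel hGy']
    rw [hd, he.self_of_nhds]
    linear_combination h1 / 2
  have hwron' : ∀ z ∈ V, w₁ z * deriv (deriv w₂) z = w₂ z * deriv (deriv w₁) z := by
    intro z hz
    have hd := Filter.EventuallyEq.deriv_eq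
      (f₁ := fun y => w₁ y * deriv w₂ y - w₂ y * deriv w₁ y) (f := fun _ => (1 / 2 : ℂ))
      (Filter.eventually_of_mem (hV.mem_nhds hz) hwron)
    have h1 := (((hW₁ z hz).differentiableAt.hasDerivAt.mul
      (hW₂ z hz).deriv.differentiableAt.hasDerivAt).sub
      ((hW₂ z hz).differentiableAt.hasDerivAt.mul
        (hW₁ z hz).deriv.differentiableAt.hasDerivAt)).deriv
    rw [deriv_const] at hd
    linear_combination h1.symm.trans hd
  let ρ : ℂ → ℂ := fun z => 8 * (deriv w₁ z * deriv (deriv w₂) z - deriv w₂ z * deriv (deriv w₁) z)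
  have hρ₁ : ∀ z ∈ V, deriv (deriv w₁) z + ρ z / 4 * w₁ z = 0 := fun z hz => by
    linear_combination 2 * deriv w₁ z * hwron' z hz - 2 * deriv (deriv w₁) z * hwron z hz
  have hρ₂ : ∀ z ∈ V, deriv (deriv w₂) z + ρ z / 4 * w₂ z = 0 := fun z hz => by
    linear_combination 2 * deriv w₂ z * hwron' z hz - 2 * deriv (deriv w₂) z * hwron z hz
  refine ⟨w₁, w₂, hw₁, hw₂, fun z hz => ⟨(hw z hz).1, (hw z hz).2.1⟩, ?_, hwron, ρ, ?_, ?_,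
    hρ₁, hρ₂⟩
  · intro z hz hGz
    refine eq_of_eventually_nhdsNE_eq (g := fun z => G z * w₁ z) (hW₂ z hz).continuousAt
      (hGz.mul (hW₁ z hz)).continuousAt ?_
    filter_upwards [hreg z hz] with y ⟨hy, hGy, hGy'⟩ using hratio y hy hGy hGy'
  · intro z hz
    exact (analyticAt_const.mul (((hW₁ z hz).deriv.mul (hW₂ z hz).deriv.deriv).sub
      ((hW₂ z hz).deriv.mul (hW₁ z hz).deriv.deriv))).differentiableAt.differentiableWithinAt
  · intro z hz hGz hGz'
    have h2 := deriv_deriv_eq_neg_schwarzian_mul hGz hGz' (hW₁ z hz) (by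
      filter_upwards [hopen z hz hGz hGz'] with y ⟨hy, hGy, hGy'⟩
      rw [(hw y hy).1, hF₁eq y hy hGy hGy'])
    have hw0 : w₁ z ≠ 0 := by
      intro h
      have h1 := (hw z hz).1
      rw [hF₁eq z hz hGz hGz', h] at h1
      simp [eq_comm, hGz'] at h1
    refine mul_right_cancel₀ hw0 ?_
    linear_combination 4 * hρ₁ z hz - 4 * h2
end

section
/- Let V ⊆ ℝ² ≅ ℂ be an open set, λ : V → ℝ a smooth function, and Δ the flat Laplacian. Define K = −e^(−2λ) Δλ (the Gauss curvature of the conformal metric e^(2λ)(dx² + dy²)). Let C ∈ ℝ and suppose K(x) ≠ 0 for all x ∈ V and the generalized Ricci condition e^(−2λ) Δ log|K| = C·K holds on V. Let α ∈ ℝ with Cα ≠ 1, set λ_α = λ + α log|K| (the conformal factor of the rescaled metric g_α = |K|^(2α) g), and define K_α = −e^(−2λ_α) Δλ_α. Then on V: K_α = (1 − Cα)|K|^(−2α) K (in particular K_α is nowhere zero), and e^(−2λ_α) Δ log|K_α| = C_α · K_α with C_α = C(2α − 1)/(Cα − 1). (This is the local coordinate form of the statement that the map g ↦ |K_g|^(2α)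 g sends metrics satisfying Δ_g log|K_g| = C·K_g to metrics satisfying Δ_{g_α} log|K_{g_α}| = C_α·K_{g_α}.) -/
/-- The flat Laplacian `Δ f = ∂²_x f + ∂²_y f` of a function `f : ℂ → ℝ`
(identifying `ℂ ≅ ℝ²`), expressed via iterated real Fréchet derivatives. -/
noncomputable def flatLaplacian (f : ℂ → ℝ) (z : ℂ) : ℝ :=
  fderiv ℝ (fun w => fderiv ℝ f w 1) z 1
    + fderiv ℝ (fun w => fderiv ℝ f w Complex.I) z Complex.I

open Filter Topology

theorem ContDiffAt.fderiv_apply_const {f : ℂ → ℝ} {z : ℂ} {m n : WithTop ℕ∞}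
    (hf : ContDiffAt ℝ n f z) (hmn : m + 1 ≤ n) (v : ℂ) :
    ContDiffAt ℝ m (fun w => fderiv ℝ f w v) z :=
  (hf.fderiv_right hmn).clm_apply contDiffAt_const

theorem ContDiffAt.flatLaplacian {f : ℂ → ℝ} {z : ℂ} (hf : ContDiffAt ℝ (⊤ : ℕ∞) f z) :
    ContDiffAt ℝ (⊤ : ℕ∞) (flatLaplacian f) z :=
  ((hf.fderiv_apply_const le_rfl 1).fderiv_apply_const le_rfl 1).add
    ((hf.fderiv_apply_const le_rfl Complex.I).fderiv_apply_const le_rfl Complex.I)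

theorem Filter.EventuallyEq.flatLaplacian_eq {f g : ℂ → ℝ} {z : ℂ} (h : f =ᶠ[𝓝 z] g) :
    flatLaplacian f z = flatLaplacian g z := by
  have key (v : ℂ) : (fun w => fderiv ℝ f w v) =ᶠ[𝓝 z] fun w => fderiv ℝ g w v :=
    h.fderiv.fun_comp (· v)
  rw [flatLaplacian, flatLaplacian, (key 1).fderiv_eq, (key Complex.I).fderiv_eq]

theorem flatLaplacian_const (c : ℝ) (z : ℂ) : flatLaplacian (fun _ => c) z = 0 := by
  simp [flatLaplacian]

theorem fderiv_add_const_mul_apply {f g : ℂ → ℝ} {z : ℂ} (hf : DifferentiableAt ℝ f z)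
    (hg : DifferentiableAt ℝ g z) (a : ℝ) (v : ℂ) :
    fderiv ℝ (fun w => f w + a * g w) z v = fderiv ℝ f z v + a * fderiv ℝ g z v := by
  rw [fderiv_fun_add hf (hg.const_mul a), fderiv_const_mul hg]
  simp

theorem flatLaplacian_add_const_mul {f g : ℂ → ℝ} {z : ℂ} (hf : ContDiffAt ℝ 2 f z)
    (hg : ContDiffAt ℝ 2 g z) (a : ℝ) :
    flatLaplacian (fun w => f w + a * g w) z = flatLaplacian f z + a * flatLaplacian g z := by
  have diff {h : ℂ → ℝ} (hh : ContDiffAt ℝ 2 h z) : ∀ᶠ w in 𝓝 z, DifferentiableAt ℝ h w :=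
    (hh.eventually (by simp)).mono fun _ hw => hw.differentiableAt (by simp)
  have key (v : ℂ) : fderiv ℝ (fun w => fderiv ℝ (fun w => f w + a * g w) w v) z v
      = fderiv ℝ (fun w => fderiv ℝ f w v) z v + a * fderiv ℝ (fun w => fderiv ℝ g w v) z v := by
    have first : (fun w => fderiv ℝ (fun w => f w + a * g w) w v)
        =ᶠ[𝓝 z] fun w => fderiv ℝ f w v + a * fderiv ℝ g w v := by
      filter_upwards [diff hf, diff hg] with w hfw hgw
      exact fderiv_add_const_mul_apply hfw hgw a v
    have second {h : ℂ → ℝ} (hh : ContDiffAt ℝ 2 h z) :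
        DifferentiableAt ℝ (fun w => fderiv ℝ h w v) z :=
      (hh.fderiv_apply_const (m := 1) (by norm_num) v).differentiableAt one_ne_zero
    rw [first.fderiv_eq, fderiv_add_const_mul_apply (second hf) (second hg)]
  simp only [flatLaplacian, key]
  ring

/-- Local coordinate form of the conformal-rescaling statement: if the conformal
metric `e^(2λ)|dz|²` has nowhere vanishing Gauss curvature `K = -e^(-2λ)Δλ`
satisfying the generalized Ricci condition `e^(-2λ) Δ log|K| = C·K`, and `α ∈ ℝ`
with `Cα ≠ 1`, then the rescaled metric with conformal factor
`λ_α = λ + α log|K|` has Gauss curvature `K_α = (1 - Cα)|K|^(-2α) K`, nowhere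
zero, satisfying `e^(-2λ_α) Δ log|K_α| = C_α·K_α` with
`C_α = C(2α - 1)/(Cα - 1)`. -/
theorem generalized_ricci_condition_conformal_rescale
    (V : Set ℂ) (hV : IsOpen V)
    (lam : ℂ → ℝ) (hlam : ContDiffOn ℝ (⊤ : ℕ∞) lam V)
    (K : ℂ → ℝ) (hK_def : ∀ z, K z = -Real.exp (-(2 * lam z)) * flatLaplacian lam z)
    (C : ℝ) (hKne : ∀ z ∈ V, K z ≠ 0)
    (hRicci : ∀ z ∈ V,
      Real.exp (-(2 * lam z)) * flatLaplacian (fun w => Real.log |K w|) z = C * K z)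
    (α : ℝ) (hα : C * α ≠ 1)
    (lamα : ℂ → ℝ) (hlamα_def : ∀ z, lamα z = lam z + α * Real.log |K z|)
    (Kα : ℂ → ℝ)
    (hKα_def : ∀ z, Kα z = -Real.exp (-(2 * lamα z)) * flatLaplacian lamα z) :
    (∀ z ∈ V, Kα z = (1 - C * α) * |K z| ^ (-(2 * α)) * K z ∧ Kα z ≠ 0) ∧
    (∀ z ∈ V,
      Real.exp (-(2 * lamα z)) * flatLaplacian (fun w => Real.log |Kα w|) z
        = (C * (2 * α - 1) / (C * α - 1)) * Kα z) := by
  have two_le : (2 : WithTop ℕ∞) ≤ ((⊤ : ℕ∞) : WithTop ℕ∞) :=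
    WithTop.coe_le_coe.2 (le_top : (2 : ℕ∞) ≤ ⊤)
  have smooth_lam (z : ℂ) (hz : z ∈ V) : ContDiffAt ℝ (⊤ : ℕ∞) lam z :=
    hlam.contDiffAt (hV.mem_nhds hz)
  have smooth_K (z : ℂ) (hz : z ∈ V) : ContDiffAt ℝ (⊤ : ℕ∞) K z := by
    rw [funext hK_def]
    exact ((contDiffAt_const.mul (smooth_lam z hz)).neg.exp.neg).mul (smooth_lam z hz).flatLaplacian
  have smooth_log (z : ℂ) (hz : z ∈ V) : ContDiffAt ℝ 2 (fun w => Real.log |K w|) z := by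
    simp only [Real.log_abs]
    exact ((smooth_K z hz).log (hKne z hz)).of_le two_le
  have exp_lamα (z : ℂ) (hz : z ∈ V) :
      Real.exp (-(2 * lamα z)) = |K z| ^ (-(2 * α)) * Real.exp (-(2 * lam z)) := by
    rw [Real.rpow_def_of_pos (abs_pos.2 (hKne z hz)), ← Real.exp_add, hlamα_def]
    congr 1
    ring
  have Kα_eq (z : ℂ) (hz : z ∈ V) : Kα z = (1 - C * α) * |K z| ^ (-(2 * α)) * K z := by
    rw [hKα_def, exp_lamα z hz, funext hlamα_def,
      flatLaplacian_add_const_mul ((smooth_lam z hz).of_le two_le)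
        (smooth_log z hz)]
    linear_combination (-|K z| ^ (-(2 * α))) * hK_def z
      - |K z| ^ (-(2 * α)) * α * hRicci z hz
  have one_sub_ne : 1 - C * α ≠ 0 := sub_ne_zero.2 hα.symm
  have sub_one_ne : C * α - 1 ≠ 0 := sub_ne_zero.2 hα
  refine ⟨fun z hz => ⟨Kα_eq z hz, ?_⟩, fun z hz => ?_⟩
  · rw [Kα_eq z hz]
    exact mul_ne_zero
      (mul_ne_zero one_sub_ne (Real.rpow_pos_of_pos (abs_pos.2 (hKne z hz)) _).ne') (hKne z hz)
  · have log_Kα : (fun w => Real.log |Kα w|)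
        =ᶠ[𝓝 z] fun w => Real.log |1 - C * α| + (1 - 2 * α) * Real.log |K w| := by
      filter_upwards [hV.mem_nhds hz] with w hw
      have hpos : 0 < |K w| := abs_pos.2 (hKne w hw)
      have hpow := Real.rpow_pos_of_pos hpos (-(2 * α))
      rw [Kα_eq w hw, abs_mul, abs_mul, abs_of_pos hpow,
        Real.log_mul (mul_ne_zero (abs_ne_zero.2 one_sub_ne) hpow.ne') hpos.ne',
        Real.log_mul (abs_ne_zero.2 one_sub_ne) hpow.ne', Real.log_rpow hpos]
      ring
    rw [log_Kα.flatLaplacian_eq, flatLaplacian_add_const_mul contDiffAt_const (smooth_log z hz),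
      flatLaplacian_const, exp_lamα z hz, Kα_eq z hz]
    have coeff : C * (2 * α - 1) / (C * α - 1) * (1 - C * α) = C * (1 - 2 * α) := by
      field_simp
      ring
    linear_combination (1 - 2 * α) * |K z| ^ (-(2 * α)) * hRicci z hz
      - |K z| ^ (-(2 * α)) * K z * coeff
end

section
/- Let w₁, w₂ : ℂ → ℂ be entire functions with w₁'' = w₂'' = 0 (i.e., both affine) satisfying the Wronskian condition w₁ w₂' − w₂ w₁' = 1/2 on ℂ. Then there exist μ > 0, τ ∈ ℂ and U ∈ SU(2) such that for all z ∈ ℂ: (w₁(z + τ), w₂(z + τ))ᵀ = U · (μ, z/(2μ))ᵀ. (This is the normal form, up to the SU(2)-action and translation, of all solutions of Hill's equation with ρ = 0 and Wronskian 1/2; it underlies the characterization that the only minimal surfaces with vanishing entropy differential are pieces of Enneper's surface, whose Weierstrass data arises from w₁ = μ, w₂ = z/(2μ).) -/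
open ComplexConjugate

/-- An entire function with vanishing second derivative is affine. -/
theorem eq_deriv_zero_mul_add_of_deriv_deriv_eq_zero {w : ℂ → ℂ}
    (hw : Differentiable ℂ w) (haff : ∀ z, deriv (deriv w) z = 0) :
    (∀ z, deriv w z = deriv w 0) ∧ ∀ z, w z = deriv w 0 * z + w 0 := by
  have hd : Differentiable ℂ (deriv w) := hw.deriv
  have hconst : ∀ z, deriv w z = deriv w 0 := fun z =>
    is_const_of_deriv_eq_zero hd haff z 0
  refine ⟨hconst, fun z => ?_⟩
  have hderiv : ∀ x, HasDerivAt (fun y => w y - deriv w 0 * y) 0 x := fun x => by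
    have h := (hw x).hasDerivAt.sub ((hasDerivAt_id x).const_mul (deriv w 0))
    rw [hconst x, mul_one, sub_self] at h
    exact h
  have h := is_const_of_deriv_eq_zero (fun x => (hderiv x).differentiableAt)
    (fun x => (hderiv x).deriv) z 0
  linear_combination h

/-- A unit vector `(c, d)` of `ℂ²` is the second column of a matrix in `SU(2)`. -/
theorem conj_completion_mem_specialUnitaryGroup {c d : ℂ}
    (h : c * conj c + d * conj d = 1) :
    !![conj d, c; -conj c, d] ∈ Matrix.specialUnitaryGroup (Fin 2) ℂ := by
  rw [Matrix.mem_specialUnitaryGroup_iff, Matrix.mem_unitaryGroup_iff]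
  refine ⟨?_, ?_⟩
  · ext i j
    fin_cases i <;> fin_cases j <;>
      simp [Matrix.mul_apply, Fin.sum_univ_two, Matrix.star_apply] <;>
      first | linear_combination h | ring
  · rw [Matrix.det_fin_two_of]
    linear_combination h


/-- Normal form, up to the `SU(2)`-action and a translation, of all pairs of
entire affine functions (solutions of Hill's equation with `ρ = 0`) with
Wronskian identically `1/2`: every such pair is obtained from
`(μ, z/(2μ))` with `μ > 0`. -/
theorem affine_wronskian_normal_form
    (w₁ w₂ : ℂ → ℂ)
    (hw₁ : Differentiable ℂ w₁) (hw₂ : Differentiable ℂ w₂)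
    (haff₁ : ∀ z, deriv (deriv w₁) z = 0)
    (haff₂ : ∀ z, deriv (deriv w₂) z = 0)
    (hW : ∀ z, w₁ z * deriv w₂ z - w₂ z * deriv w₁ z = 1 / 2) :
    ∃ (μ : ℝ), 0 < μ ∧ ∃ (τ : ℂ) (U : Matrix (Fin 2) (Fin 2) ℂ),
      U ∈ Matrix.specialUnitaryGroup (Fin 2) ℂ ∧
      ∀ z : ℂ,
        w₁ (z + τ) = U 0 0 * (μ : ℂ) + U 0 1 * (z / (2 * (μ : ℂ))) ∧
        w₂ (z + τ) = U 1 0 * (μ : ℂ) + U 1 1 * (z / (2 * (μ : ℂ))) := by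
  obtain ⟨hd₁, hf₁⟩ := eq_deriv_zero_mul_add_of_deriv_deriv_eq_zero hw₁ haff₁
  obtain ⟨hd₂, hf₂⟩ := eq_deriv_zero_mul_add_of_deriv_deriv_eq_zero hw₂ haff₂
  have hW₀ := hW 0
  generalize deriv w₁ 0 = a₁ at *
  generalize deriv w₂ 0 = a₂ at *
  generalize w₁ 0 = b₁ at *
  generalize w₂ 0 = b₂ at *
  have hpos : 0 < Complex.normSq a₁ + Complex.normSq a₂ := by
    by_cases h₁ : a₁ = 0
    · have h₂ : a₂ ≠ 0 := by
        rintro rfl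
        simp [h₁] at hW₀
      linarith [Complex.normSq_nonneg a₁, Complex.normSq_pos.2 h₂]
    · linarith [Complex.normSq_nonneg a₂, Complex.normSq_pos.2 h₁]
  obtain ⟨n, hn, hnn⟩ : ∃ n : ℝ, 0 < n ∧ n ^ 2 = Complex.normSq a₁ + Complex.normSq a₂ :=
    ⟨_, Real.sqrt_pos.2 hpos, Real.sq_sqrt hpos.le⟩
  have hN : a₁ * conj a₁ + a₂ * conj a₂ = (n : ℂ) ^ 2 := by
    rw [Complex.mul_conj, Complex.mul_conj]
    exact_mod_cast hnn.symm
  have hn₀ : (n : ℂ) ≠ 0 := by exact_mod_cast hn.ne'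
  refine ⟨1 / (2 * n), by positivity, -(b₁ * conj a₁ + b₂ * conj a₂) / (n : ℂ) ^ 2,
    !![conj (a₂ / n), a₁ / n; -conj (a₁ / n), a₂ / n],
    conj_completion_mem_specialUnitaryGroup ?_, fun z => ⟨?_, ?_⟩⟩
  · simp only [map_div₀, Complex.conj_ofReal]
    field_simp
    linear_combination hN
  · rw [hf₁]
    simp
    field_simp
    linear_combination 2 * conj a₂ * hW₀ - 2 * b₁ * hN
  · rw [hf₂]
    simp
    field_simp
    linear_combination -2 * conj a₁ * hW₀ - 2 * b₂ * hN
end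

section
/- Fix constants C > 0, R > 0 and a point p ∈ ℝ³. Let Σ be a nonempty subset of the open ball B_{2R}(p) ⊆ ℝ³ that is closed as a subset of B_{2R}(p), and let f : Σ → ℝ be a continuous nonnegative function. If sup_{Σ ∩ B_R(p)} f ≥ 4C/R, then there exist a point q ∈ Σ and a scale s > 0 such that f(q) = 1/s, the ball B_{Cs}(q) is contained in B_{2R}(p), and f(x) ≤ 2/s for every x ∈ Σ ∩ B_{Cs}(q). -/
open Metric

/-- A subset that is relatively closed in an open ball of a proper space meets every smaller closed
concentric ball in a compact set. -/
theorem isCompact_inter_closedBall_of_isClosed_preimage_ball {X : Type*} [PseudoMetricSpace X]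
    [ProperSpace X] {S : Set X} {p : X} {r ρ : ℝ}
    (hS : IsClosed (Subtype.val ⁻¹' S : Set (ball p ρ))) (hr : r < ρ) :
    IsCompact (S ∩ closedBall p r) := by
  obtain ⟨T, hT, hTS⟩ := isClosed_induced_iff.mp hS
  have heq : S ∩ closedBall p r = T ∩ closedBall p r := by
    ext x
    refine and_congr_left fun hx => ?_
    exact (Set.ext_iff.mp hTS ⟨x, closedBall_subset_ball hr hx⟩).symm
  rw [heq]
  exact (isCompact_closedBall p r).inter_left hT

/-- Point selection by maximizing `(r - dist x p) * f x`. -/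
theorem exists_forall_ball_le_two_mul {X : Type*} [PseudoMetricSpace X] {S : Set X} {p x₀ : X}
    {f : X → ℝ} {C r : ℝ} (hC : 0 < C) (hK : IsCompact (S ∩ closedBall p r))
    (hf : ContinuousOn f S) (hx₀ : x₀ ∈ S ∩ closedBall p r)
    (h : 2 * C ≤ (r - dist x₀ p) * f x₀) :
    ∃ q ∈ S, 0 < f q ∧ ball q (C / f q) ⊆ ball p r ∧
      ∀ x ∈ S ∩ ball q (C / f q), f x ≤ 2 * f q := by
  have hcont : ContinuousOn (fun x => (r - dist x p) * f x) (S ∩ closedBall p r) :=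
    (by fun_prop : Continuous fun x => r - dist x p).continuousOn.mul
      (hf.mono Set.inter_subset_left)
  obtain ⟨q, ⟨hqS, hqr⟩, hmax⟩ := hK.exists_isMaxOn ⟨x₀, hx₀⟩ hcont
  have hq : 2 * C ≤ (r - dist q p) * f q := h.trans (hmax hx₀)
  have hqd : 0 ≤ r - dist q p := sub_nonneg.mpr hqr
  have hfq : 0 < f q := pos_of_mul_pos_right (by linarith) hqd
  have hrad : 2 * (C / f q) ≤ r - dist q p := by
    rwa [← mul_div_assoc, div_le_iff₀ hfq]
  have hdist : ∀ x ∈ ball q (C / f q), r - dist q p < 2 * (r - dist x p) := by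
    intro x hx
    linarith [mem_ball.mp hx, dist_triangle x q p]
  have hsub : ball q (C / f q) ⊆ ball p r := by
    intro x hx
    rw [mem_ball]
    linarith [hdist x hx]
  refine ⟨q, hqS, hfq, hsub, fun x ⟨hxS, hx⟩ => ?_⟩
  have hle : (r - dist x p) * f x ≤ (r - dist q p) * f q :=
    hmax ⟨hxS, ball_subset_closedBall (hsub hx)⟩
  have hxd : 0 < r - dist x p := sub_pos.mpr (hsub hx)
  refine le_of_mul_le_mul_left ?_ hxd
  nlinarith [hdist x hx]

/-- Point-selection lemma for the blow-up argument: if `S` is a nonempty subset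
of `B_{2R}(p) ⊆ ℝ³`, closed as a subset of `B_{2R}(p)`, and `f : S → ℝ` is
continuous and nonnegative with `sup_{S ∩ B_R(p)} f ≥ 4C/R`, then there are
`q ∈ S` and a scale `s > 0` with `f(q) = 1/s`, `B_{Cs}(q) ⊆ B_{2R}(p)`, and
`f ≤ 2/s` on `S ∩ B_{Cs}(q)`. -/
theorem blow_up_point_selection
    (C R : ℝ) (hC : 0 < C) (hR : 0 < R)
    (p : EuclideanSpace ℝ (Fin 3))
    (S : Set (EuclideanSpace ℝ (Fin 3))) (hSne : S.Nonempty)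
    (hSsub : S ⊆ ball p (2 * R))
    (hSclosed : IsClosed (Subtype.val ⁻¹' S : Set (ball p (2 * R))))
    (f : EuclideanSpace ℝ (Fin 3) → ℝ)
    (hf : ContinuousOn f S) (hf0 : ∀ x ∈ S, 0 ≤ f x)
    (hsup : 4 * C / R ≤ sSup (f '' (S ∩ ball p R))) :
    ∃ q ∈ S, ∃ s : ℝ, 0 < s ∧ f q = 1 / s ∧
      ball q (C * s) ⊆ ball p (2 * R) ∧
      ∀ x ∈ S ∩ ball q (C * s), f x ≤ 2 / s := by
  have hpos : 0 < 4 * C / R := by positivity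
  have hne : (S ∩ ball p R).Nonempty := by
    by_contra! hempty
    rw [hempty, Set.image_empty, Real.sSup_empty] at hsup
    linarith
  have hKR : IsCompact (S ∩ closedBall p R) :=
    isCompact_inter_closedBall_of_isClosed_preimage_ball hSclosed (by linarith)
  have hK : IsCompact (S ∩ closedBall p (3 * R / 2)) :=
    isCompact_inter_closedBall_of_isClosed_preimage_ball hSclosed (by linarith)
  have hsub : S ∩ ball p R ⊆ S ∩ closedBall p R :=
    Set.inter_subset_inter_right S ball_subset_closedBall
  obtain ⟨x₀, ⟨hx₀S, hx₀R⟩, hmax⟩ :=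
    hKR.exists_isMaxOn (hne.mono hsub) (hf.mono Set.inter_subset_left)
  have hx₀ : 4 * C / R ≤ f x₀ :=
    hsup.trans (csSup_le (hne.image f) (Set.forall_mem_image.mpr fun x hx => hmax (hsub hx)))
  rw [mem_closedBall] at hx₀R
  have hF : 2 * C ≤ (3 * R / 2 - dist x₀ p) * f x₀ := by
    calc 2 * C = R / 2 * (4 * C / R) := by field_simp; norm_num
      _ ≤ (3 * R / 2 - dist x₀ p) * f x₀ := by gcongr; linarith; linarith
  obtain ⟨q, hqS, hfq, hball, hle⟩ := exists_forall_ball_le_two_mul hC hK hf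
    ⟨hx₀S, mem_closedBall.mpr (by linarith)⟩ hF
  refine ⟨q, hqS, 1 / f q, by positivity, (one_div_one_div _).symm, ?_, ?_⟩
  · rw [mul_one_div]
    exact hball.trans (ball_subset_ball (by linarith))
  · rw [mul_one_div, div_div_eq_mul_div, div_one]
    exact hle
end
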